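/- arXiv:1007.1956 — 2 statements merged into one kernel-verified Lean document; each statement's English description precedes it below -/
import Mathlib

section
/- Let R be a commutative ring in which 6 is invertible and let a : Z₄ → R be a family of elements, written a_{ij} := a(i,j) for (i,j) ∈ Z₄. Assume: (i) the symmetry relations a₁₁ = a₃₃, a₁₀ = a₃₀, a₀₁ = a₀₃, a₁₃ = a₃₁, a₃₂ = a₁₂, a₂₁ = a₂₃ hold; (ii) for every pair of triples (x,y₁,z₁), (x,y₂,z₂) ∈ S with (x,y₁,z₁) ∼ (x,y₂,z₂), one has ∑_{u ∈ Z₂} a_{M(y₁+u)} · a_{z₁+u} = ∑_{v ∈ Z₂} a_{M(y₂+v)} · a_{z₂+v}. Then the following three equations hold: a₁₃² − a₁₀a₂₁ − a₁₂a₀₁ + a₁₁² = 0; −a₀₀a₀₂ + 2a₁₀a₀₁ − a₂₂a₂₀ − a₀₂a₂₂ − a₂₀a₀₀ + 2a₁₂a₂₁ = 0; −a₂₀² − 2a₀₀a₂₂ − a₀₂² + 4a₁₃a₁₁ = 0. -/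
/-- `Z₄ = (ℤ/4ℤ)²`. -/
abbrev Z4 : Type := (ZMod 4) × (ZMod 4)

/-- Membership in the 2-torsion subgroup `Z₂ ⊆ Z₄`. -/
def inZ2 (u : Z4) : Prop := u + u = 0

instance : DecidablePred inZ2 := fun u => inferInstanceAs (Decidable (u + u = 0))

/-- The index set `S = {(x,y,z) ∈ Z₄³ : x−2y ∈ Z₂, x+y−z ∈ Z₂, x+y+z ∈ Z₂}`. -/
def Sset : Set (Z4 × Z4 × Z4) :=
  {p | inZ2 (p.1 - 2 * p.2.1) ∧ inZ2 (p.1 + p.2.1 - p.2.2) ∧ inZ2 (p.1 + p.2.1 + p.2.2)}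

/-- The triple `(x−2y, x+y−z, x+y+z)` attached to `(x,y,z)`. -/
def tripleOf (p : Z4 × Z4 × Z4) : Fin 3 → Z4 :=
  ![p.1 - 2 * p.2.1, p.1 + p.2.1 - p.2.2, p.1 + p.2.1 + p.2.2]

/-- The equivalence `∼`: the attached triples agree up to permutation. -/
def simRel (p q : Z4 × Z4 × Z4) : Prop :=
  ∃ σ : Equiv.Perm (Fin 3), ∀ i, tripleOf p i = tripleOf q (σ i)

/-- The map `M : Z₄ → Z₄` given by the matrix `[[0,3],[1,0]]`, i.e. `M(i,j) = (3j, i)`. -/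
def Mmap (u : Z4) : Z4 := (3 * u.2, u.1)

theorem sqrt3_relations_imply_corr {R : Type*} [CommRing R]
    (h6 : IsUnit (6 : R)) (a : Z4 → R)
    (hsym : a (1,1) = a (3,3) ∧ a (1,0) = a (3,0) ∧ a (0,1) = a (0,3) ∧
            a (1,3) = a (3,1) ∧ a (3,2) = a (1,2) ∧ a (2,1) = a (2,3))
    (hrel : ∀ x y₁ z₁ y₂ z₂ : Z4, (x, y₁, z₁) ∈ Sset → (x, y₂, z₂) ∈ Sset →
      simRel (x, y₁, z₁) (x, y₂, z₂) →
      ∑ u ∈ Finset.univ.filter inZ2, a (Mmap (y₁ + u)) * a (z₁ + u) =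
      ∑ v ∈ Finset.univ.filter inZ2, a (Mmap (y₂ + v)) * a (z₂ + v)) :
    a (1,3) ^ 2 - a (1,0) * a (2,1) - a (1,2) * a (0,1) + a (1,1) ^ 2 = 0 ∧
    -(a (0,0) * a (0,2)) + 2 * (a (1,0) * a (0,1)) - a (2,2) * a (2,0) - a (0,2) * a (2,2)
      - a (2,0) * a (0,0) + 2 * (a (1,2) * a (2,1)) = 0 ∧
    -(a (2,0) ^ 2) - 2 * (a (0,0) * a (2,2)) - a (0,2) ^ 2 + 4 * (a (1,3) * a (1,1)) = 0 := by
  obtain ⟨s1, s2, s3, s4, s5, s6⟩ := hsym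
  have hS : Finset.univ.filter inZ2 = ({(0,0), (0,2), (2,0), (2,2)} : Finset Z4) := by decide
  have key : ∀ y z : Z4, ∑ u ∈ Finset.univ.filter inZ2, a (Mmap (y + u)) * a (z + u) =
      a (Mmap (y + (0,0))) * a (z + (0,0)) + (a (Mmap (y + (0,2))) * a (z + (0,2)) +
      (a (Mmap (y + (2,0))) * a (z + (2,0)) + a (Mmap (y + (2,2))) * a (z + (2,2)))) := by
    intro y z
    rw [hS, Finset.sum_insert (by decide), Finset.sum_insert (by decide),
      Finset.sum_insert (by decide), Finset.sum_singleton]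
  simp only [key] at hrel
  have e1 := hrel (0,0) (0,1) (0,1) (0,0) (0,2)
    (by unfold Sset; simp only [Set.mem_setOf_eq]; decide)
    (by unfold Sset; simp only [Set.mem_setOf_eq]; decide) (by unfold simRel; decide)
  have e2 := hrel (0,0) (1,1) (1,1) (0,0) (2,2)
    (by unfold Sset; simp only [Set.mem_setOf_eq]; decide)
    (by unfold Sset; simp only [Set.mem_setOf_eq]; decide) (by unfold simRel; decide)
  have e3 := hrel (0,0) (1,1) (1,3) (0,1) (2,1)
    (by unfold Sset; simp only [Set.mem_setOf_eq]; decide)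
    (by unfold Sset; simp only [Set.mem_setOf_eq]; decide) (by unfold simRel; decide)
  change a (3,0) * a (0,1) + (a (1,0) * a (0,3) + (a (3,2) * a (2,1) + a (1,2) * a (2,3))) =
    a (0,0) * a (0,2) + (a (2,0) * a (0,0) + (a (0,2) * a (2,2) + a (2,2) * a (2,0))) at e1
  change a (3,1) * a (1,1) + (a (1,1) * a (1,3) + (a (3,3) * a (3,1) + a (1,3) * a (3,3))) =
    a (0,0) * a (2,2) + (a (2,0) * a (2,0) + (a (0,2) * a (0,2) + a (2,2) * a (0,0))) at e2
  change a (3,1) * a (1,3) + (a (1,1) * a (1,1) + (a (3,3) * a (3,3) + a (1,3) * a (3,1))) =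
    a (3,0) * a (2,1) + (a (1,0) * a (2,3) + (a (3,2) * a (0,1) + a (1,2) * a (0,3))) at e3
  rw [← s2, ← s3, s5, ← s6] at e1
  rw [← s1, ← s4] at e2
  rw [← s1, ← s2, ← s3, ← s4, s5, ← s6] at e3
  have h2 : IsUnit (2 : R) := by
    have h : (6 : R) = 2 * 3 := by norm_num
    rw [h] at h6
    exact isUnit_of_mul_isUnit_left h6
  refine ⟨?_, ?_, ?_⟩
  · apply h2.mul_left_cancel
    linear_combination e3
  · linear_combination e1
  · linear_combination e2
end

section
/- Let R be a commutative ring and let x₀, x₁, x₂, x₃, y₀, y₁, y₂, y₃ ∈ R satisfy x₁ = x₃, y₁ = y₃, (x₀² + x₂²)x₀x₂ = 2x₁⁴, and (y₀² + y₂²)y₀y₂ = 2y₁⁴. For i, j ∈ ℤ/4ℤ define a_{ij} := x_i · y_j. Then (a_{ij}) satisfies all of Mumford's level-4 theta relations, namely (writing Σ := a₀₀² + a₀₂² + a₂₀² + a₂₂²): Σ(a₀₀a₀₂ + a₂₀a₂₂) = 2(a₀₁² + a₂₁²)²; Σ(a₀₀a₂₀ + a₀₂a₂₂) = 2(a₁₀²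 + a₁₂²)²; Σ(a₀₀a₂₂ + a₂₀a₀₂) = 2(a₁₁² + a₁₃²)²; (a₀₀a₂₀ + a₀₂a₂₂)(a₀₀a₂₂ + a₀₂a₂₀) = 4a₀₁²a₂₁²; (a₀₀a₀₂ + a₂₀a₂₂)(a₀₀a₂₂ + a₀₂a₂₀) = 4a₁₀²a₁₂²; (a₀₀a₀₂ + a₂₀a₂₂)(a₀₀a₂₀ + a₀₂a₂₂) = 4a₁₁²a₁₃²; Σ·a₁₃a₁₁ = (a₁₂² + a₁₀²)(a₀₁² + a₂₁²); Σ·a₀₁a₂₁ = (a₁₂² + a₁₀²)(a₁₁² + a₁₃²); Σ·a₁₀a₁₂ = (a₀₁² + a₂₁²)(a₁₁² + a₁₃²); (a₀₂a₂₀ + a₀₀a₂₂)a₁₁a₁₃ = 2a₀₁a₁₀a₂₁a₁₂; (a₂₀a₀₀ + a₂₂a₀₂)a₁₀a₁₂ = 2a₁₁a₁₃a₂₁a₀₁; (a₀₀a₀₂ + a₂₀a₂₂)a₂₁a₀₁ = 2a₁₁a₁₃a₁₀a₁₂; (a₀₂a₂₀ + a₀₀a₂₂)(a₀₁² + a₂₁²)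 = 2a₁₀a₁₂(a₁₁² + a₁₃²); (a₀₀a₀₂ + a₂₀a₂₂)(a₁₁² + a₁₃²) = 2a₁₀a₁₂(a₀₁² + a₂₁²); (a₀₂a₂₀ + a₀₀a₂₂)(a₁₀² + a₁₂²) = 2a₂₁a₀₁(a₁₁² + a₁₃²); (a₂₀a₀₀ + a₂₂a₀₂)(a₁₃² + a₁₁²) = 2a₂₁a₀₁(a₁₀² + a₁₂²); (a₂₀a₀₀ + a₂₂a₀₂)(a₂₁² + a₀₁²) = 2a₁₁a₁₃(a₁₀² + a₁₂²); (a₀₀a₀₂ + a₂₀a₂₂)(a₁₂² + a₁₀²) = 2a₁₁a₁₃(a₀₁² + a₂₁²); a₀₁a₂₁(a₀₁² + a₂₁²) = a₁₀a₁₂(a₁₀² + a₁₂²); a₀₁a₂₁(a₀₁² + a₂₁²) = a₁₁a₁₃(a₁₁² + a₁₃²); together with the symmetry relations a₁₁ = a₃₃, a₁₀ = a₃₀, a₀₁ = a₀₃, a₁₃ = a₃₁, a₃₂ = a₁₂, a₂₁ = a₂₃. -/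
theorem product_point_satisfies_mumford {R : Type*} [CommRing R]
    (x y : ZMod 4 → R)
    (hx13 : x 1 = x 3) (hy13 : y 1 = y 3)
    (hx : (x 0 ^ 2 + x 2 ^ 2) * x 0 * x 2 = 2 * x 1 ^ 4)
    (hy : (y 0 ^ 2 + y 2 ^ 2) * y 0 * y 2 = 2 * y 1 ^ 4)
    (a : ZMod 4 → ZMod 4 → R) (ha : ∀ i j, a i j = x i * y j) :
    (a 0 0 ^ 2 + a 0 2 ^ 2 + a 2 0 ^ 2 + a 2 2 ^ 2) * (a 0 0 * a 0 2 + a 2 0 * a 2 2) =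
      2 * (a 0 1 ^ 2 + a 2 1 ^ 2) ^ 2 ∧
    (a 0 0 ^ 2 + a 0 2 ^ 2 + a 2 0 ^ 2 + a 2 2 ^ 2) * (a 0 0 * a 2 0 + a 0 2 * a 2 2) =
      2 * (a 1 0 ^ 2 + a 1 2 ^ 2) ^ 2 ∧
    (a 0 0 ^ 2 + a 0 2 ^ 2 + a 2 0 ^ 2 + a 2 2 ^ 2) * (a 0 0 * a 2 2 + a 2 0 * a 0 2) =
      2 * (a 1 1 ^ 2 + a 1 3 ^ 2) ^ 2 ∧
    (a 0 0 * a 2 0 + a 0 2 * a 2 2) * (a 0 0 * a 2 2 + a 0 2 * a 2 0) =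
      4 * (a 0 1 ^ 2 * a 2 1 ^ 2) ∧
    (a 0 0 * a 0 2 + a 2 0 * a 2 2) * (a 0 0 * a 2 2 + a 0 2 * a 2 0) =
      4 * (a 1 0 ^ 2 * a 1 2 ^ 2) ∧
    (a 0 0 * a 0 2 + a 2 0 * a 2 2) * (a 0 0 * a 2 0 + a 0 2 * a 2 2) =
      4 * (a 1 1 ^ 2 * a 1 3 ^ 2) ∧
    (a 0 0 ^ 2 + a 0 2 ^ 2 + a 2 0 ^ 2 + a 2 2 ^ 2) * (a 1 3 * a 1 1) =
      (a 1 2 ^ 2 + a 1 0 ^ 2) * (a 0 1 ^ 2 + a 2 1 ^ 2) ∧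
    (a 0 0 ^ 2 + a 0 2 ^ 2 + a 2 0 ^ 2 + a 2 2 ^ 2) * (a 0 1 * a 2 1) =
      (a 1 2 ^ 2 + a 1 0 ^ 2) * (a 1 1 ^ 2 + a 1 3 ^ 2) ∧
    (a 0 0 ^ 2 + a 0 2 ^ 2 + a 2 0 ^ 2 + a 2 2 ^ 2) * (a 1 0 * a 1 2) =
      (a 0 1 ^ 2 + a 2 1 ^ 2) * (a 1 1 ^ 2 + a 1 3 ^ 2) ∧
    (a 0 2 * a 2 0 + a 0 0 * a 2 2) * (a 1 1 * a 1 3) =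
      2 * (a 0 1 * a 1 0 * a 2 1 * a 1 2) ∧
    (a 2 0 * a 0 0 + a 2 2 * a 0 2) * (a 1 0 * a 1 2) =
      2 * (a 1 1 * a 1 3 * a 2 1 * a 0 1) ∧
    (a 0 0 * a 0 2 + a 2 0 * a 2 2) * (a 2 1 * a 0 1) =
      2 * (a 1 1 * a 1 3 * a 1 0 * a 1 2) ∧
    (a 0 2 * a 2 0 + a 0 0 * a 2 2) * (a 0 1 ^ 2 + a 2 1 ^ 2) =
      2 * (a 1 0 * a 1 2 * (a 1 1 ^ 2 + a 1 3 ^ 2)) ∧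
    (a 0 0 * a 0 2 + a 2 0 * a 2 2) * (a 1 1 ^ 2 + a 1 3 ^ 2) =
      2 * (a 1 0 * a 1 2 * (a 0 1 ^ 2 + a 2 1 ^ 2)) ∧
    (a 0 2 * a 2 0 + a 0 0 * a 2 2) * (a 1 0 ^ 2 + a 1 2 ^ 2) =
      2 * (a 2 1 * a 0 1 * (a 1 1 ^ 2 + a 1 3 ^ 2)) ∧
    (a 2 0 * a 0 0 + a 2 2 * a 0 2) * (a 1 3 ^ 2 + a 1 1 ^ 2) =
      2 * (a 2 1 * a 0 1 * (a 1 0 ^ 2 + a 1 2 ^ 2)) ∧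
    (a 2 0 * a 0 0 + a 2 2 * a 0 2) * (a 2 1 ^ 2 + a 0 1 ^ 2) =
      2 * (a 1 1 * a 1 3 * (a 1 0 ^ 2 + a 1 2 ^ 2)) ∧
    (a 0 0 * a 0 2 + a 2 0 * a 2 2) * (a 1 2 ^ 2 + a 1 0 ^ 2) =
      2 * (a 1 1 * a 1 3 * (a 0 1 ^ 2 + a 2 1 ^ 2)) ∧
    a 0 1 * a 2 1 * (a 0 1 ^ 2 + a 2 1 ^ 2) = a 1 0 * a 1 2 * (a 1 0 ^ 2 + a 1 2 ^ 2) ∧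
    a 0 1 * a 2 1 * (a 0 1 ^ 2 + a 2 1 ^ 2) = a 1 1 * a 1 3 * (a 1 1 ^ 2 + a 1 3 ^ 2) ∧
    a 1 1 = a 3 3 ∧ a 1 0 = a 3 0 ∧ a 0 1 = a 0 3 ∧
    a 1 3 = a 3 1 ∧ a 3 2 = a 1 2 ∧ a 2 1 = a 2 3 := by
  simp only [ha, ← hx13, ← hy13]
  generalize x 0 = x0 at *
  generalize x 1 = x1 at *
  generalize x 2 = x2 at *
  generalize y 0 = y0 at *
  generalize y 1 = y1 at *
  generalize y 2 = y2 at *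
  clear ha hx13 hy13
  refine ⟨?_, ?_, ?_, ?_, ?_, ?_, ?_, ?_, ?_, ?_, ?_, ?_, ?_, ?_, ?_, ?_, ?_, ?_, ?_, ?_,
    by trivial⟩
  · linear_combination (x0 ^ 2 + x2 ^ 2) ^ 2 * hy
  · linear_combination (y0 ^ 2 + y2 ^ 2) ^ 2 * hx
  · linear_combination 2 * (y0 ^ 2 + y2 ^ 2) * (y0 * y2) * hx + 4 * x1 ^ 4 * hy
  · linear_combination 2 * (x0 * x2) ^ 2 * hy
  · linear_combination 2 * (y0 * y2) ^ 2 * hx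
  · linear_combination (y0 ^ 2 + y2 ^ 2) * (y0 * y2) * hx + 2 * x1 ^ 4 * hy
  · ring
  · linear_combination (y0 ^ 2 + y2 ^ 2) * y1 ^ 2 * hx
  · linear_combination (x0 ^ 2 + x2 ^ 2) * x1 ^ 2 * hy
  · ring
  · linear_combination (x0 * x2) * x1 ^ 2 * hy
  · linear_combination (y0 * y2) * y1 ^ 2 * hx
  · linear_combination 2 * (y0 * y2) * y1 ^ 2 * hx
  · ring
  · linear_combination 2 * (x0 * x2) * x1 ^ 2 * hy
  · ring
  · linear_combination (y0 ^ 2 + y2 ^ 2) * y1 ^ 2 * hx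
  · linear_combination (x0 ^ 2 + x2 ^ 2) * x1 ^ 2 * hy
  · linear_combination y1 ^ 4 * hx - x1 ^ 4 * hy
  · linear_combination y1 ^ 4 * hx
end
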